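/- Let α = (α_i)_{i≥0} be a complex weight that is regular with limit 1, suppose l₁,…,lₙ are not all equal, and fix 0 < ε < 1. Then lim_{k→∞} (#𝒜̃′_{k+S_𝔩,𝓜,ε}) / W_{(k,n)} = 1. -/

import Mathlib

/-- `W = {i ∈ ℕⁿ : d ≤ i₁ < i₂ < ⋯ < iₙ}`. -/
def Wset (n d : ℕ) : Set (Fin n → ℕ) :=
  {i | (∀ r, d ≤ i r) ∧ StrictMono i}

/-- `|𝔩| = |l₁| + ⋯ + |lₙ|`. -/
def Lnorm {n : ℕ} (l : Fin n → ℤ) : ℕ := ∑ a, (l a).natAbs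

/-- `𝔚 = {i + t ∈ ℕⁿ : i ∈ W, t ∈ ℤⁿ, |t_r| ≤ |𝔩| for each r, and the coordinates
`i₁+t₁, …, iₙ+tₙ` pairwise distinct}`. -/
def Wfrak {n : ℕ} (l : Fin n → ℤ) (d : ℕ) : Set (Fin n → ℕ) :=
  {w | ∃ i ∈ Wset n d, ∃ t : Fin n → ℤ,
        (∀ r, (t r).natAbs ≤ Lnorm l) ∧
        (∀ r, (w r : ℤ) = (i r : ℤ) + t r) ∧
        Function.Injective fun r => (i r : ℤ) + t r}

/-- `W′ = {i ∈ W : i_r − i_{r−1} > 4|𝔩| for all consecutive indices}`. -/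
def Wprime {n : ℕ} (l : Fin n → ℤ) (d : ℕ) : Set (Fin n → ℕ) :=
  {i | i ∈ Wset n d ∧ ∀ a b : Fin n, (a : ℕ) + 1 = (b : ℕ) →
        i a + 4 * Lnorm l < i b}

-- `𝓜`: the number of distinct rearrangements `l_π` of the tuple `l`.
open Classical in
noncomputable def Mcount {n : ℕ} (l : Fin n → ℤ) : ℕ :=
  (Finset.univ.image fun π : Equiv.Perm (Fin n) => l ∘ π).card

/-- `e_m`, `m ∈ ℤ`: the standard basis vector of the free real vector space on `ℕ`,
viewed inside its exterior algebra, with the convention `e_m = 0` for `m < 0`. -/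
noncomputable def evec (m : ℤ) : ExteriorAlgebra ℝ (ℕ →₀ ℝ) :=
  if 0 ≤ m then ExteriorAlgebra.ι ℝ (Finsupp.single m.toNat (1 : ℝ)) else 0

/-- `e_{a₁} ∧ ⋯ ∧ e_{aₙ}`: the product `ι(e_{a₁})⋯ι(e_{aₙ})` in the exterior algebra. -/
noncomputable def wedge {n : ℕ} (idx : Fin n → ℤ) : ExteriorAlgebra ℝ (ℕ →₀ ℝ) :=
  (List.ofFn fun r => evec (idx r)).prod

/-- `ℛ_i = {j ∈ ℕⁿ : d ≤ j₁ < ⋯ < jₙ, ∃ π ∈ Σₙ,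
`e_{j₁+l_{π(1)}} ∧ ⋯ ∧ e_{jₙ+l_{π(n)}} = e_{i₁} ∧ ⋯ ∧ e_{iₙ}}`. -/
def Rcal {n : ℕ} (l : Fin n → ℤ) (d : ℕ) (i : Fin n → ℕ) : Set (Fin n → ℕ) :=
  {j | j ∈ Wset n d ∧ ∃ π : Equiv.Perm (Fin n),
        wedge (fun r => (j r : ℤ) + l (π r)) = wedge (fun r => (i r : ℤ))}

/-- The weight extended to integer indices by `α_m = 0` for `m < 0`. -/
noncomputable def alphaE (α : ℕ → ℂ) (m : ℤ) : ℂ :=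
  if 0 ≤ m then α m.toNat else 0

/-- `Γ_{i,t}`: equal to `min{|α_i|,…,|α_{i+t−1}|}` if `t > 0`, to `1` if `t = 0`,
and to `min{|α_{i−1}|,…,|α_{i+t}|}` if `t < 0`. -/
noncomputable def Gamma (α : ℕ → ℂ) (i : ℕ) (t : ℤ) : ℝ :=
  if t = 0 then 1
  else sInf {x : ℝ | ∃ s : ℕ, s < t.natAbs ∧
    x = ‖alphaE α (if 0 < t then (i : ℤ) + s else (i : ℤ) - 1 - s)‖}

/-- `𝓔_{r,m} = {j ∈ 𝔚 : |j| = r, #ℛ_j = m}` (empty for `r < 0`). -/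
def Ecal {n : ℕ} (l : Fin n → ℤ) (d : ℕ) (r : ℤ) (m : ℕ) : Set (Fin n → ℕ) :=
  {j | j ∈ Wfrak l d ∧ (∑ a, (j a : ℤ)) = r ∧ Set.ncard (Rcal l d j) = m}

/-- `𝒜̃_{k+S_𝔩,𝓜,ε} = {j ∈ 𝓔_{k+S_𝔩,𝓜} : Γ_{j_m,−l_{π(m)}} > 1−ε for all m, π}`. -/
def AtildeCal {n : ℕ} (l : Fin n → ℤ) (d : ℕ) (α : ℕ → ℂ) (ε : ℝ) (k : ℤ) :
    Set (Fin n → ℕ) :=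
  {j | j ∈ Ecal l d (k + ∑ a, l a) (Mcount l) ∧
        ∀ (m : Fin n) (π : Equiv.Perm (Fin n)), 1 - ε < Gamma α (j m) (- l (π m))}


/-- `𝓔′_{r,m} = {j ∈ W′ : |j| = r, #ℛ_j = m}`. -/
def EcalP {n : ℕ} (l : Fin n → ℤ) (d : ℕ) (r : ℤ) (m : ℕ) : Set (Fin n → ℕ) :=
  {j | j ∈ Wprime l d ∧ (∑ a, (j a : ℤ)) = r ∧ Set.ncard (Rcal l d j) = m}


lemma wedge_eq_perm {n : ℕ} (a : Fin n → ℤ) (j : Fin n → ℕ) (hj : Function.Injective j)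
    (h : wedge a = wedge (fun r => (j r : ℤ))) :
    ∃ σ : Equiv.Perm (Fin n), ∀ r, a r = (j (σ r) : ℤ) := by
  classical
  let g : (ℕ →₀ ℝ) →ₗ[ℝ] (Fin n → ℝ) := LinearMap.pi fun s => Finsupp.lapply (j s)
  let F : (ℕ →₀ ℝ) [⋀^Fin n]→ₗ[ℝ] ℝ :=
    (Matrix.detRowAlternating (R := ℝ) (n := Fin n)).compLinearMap g
  let Φ : ExteriorAlgebra ℝ (ℕ →₀ ℝ) →ₗ[ℝ] ℝ :=
    ExteriorAlgebra.liftAlternating (Function.update 0 n F)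
  let v : (Fin n → ℤ) → Fin n → (ℕ →₀ ℝ) := fun a r =>
    if 0 ≤ a r then Finsupp.single (a r).toNat (1 : ℝ) else 0
  have hw : ∀ b : Fin n → ℤ, wedge b = ExteriorAlgebra.ιMulti ℝ n (v b) := by
    intro b
    rw [ExteriorAlgebra.ιMulti_apply, wedge]
    congr 2
    funext r
    simp only [evec, v]
    split_ifs <;> simp
  have hΦ : ∀ b : Fin n → ℤ, Φ (wedge b) =
      Matrix.det (Matrix.of fun r s => (v b r) (j s)) := by
    intro b
    rw [hw b]
    simp only [Φ]
    rw [ExteriorAlgebra.liftAlternating_apply_ιMulti]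
    simp only [Function.update_self, F]
    rfl
  have h1 : Φ (wedge (fun r => (j r : ℤ))) = 1 := by
    rw [hΦ]
    convert Matrix.det_one (n := Fin n) (R := ℝ)
    ext r s
    simp [v, Matrix.one_apply, Finsupp.single_apply, hj.eq_iff]
  have h2 : Matrix.det (Matrix.of fun r s => (v a r) (j s)) ≠ 0 := by
    rw [← hΦ, h, h1]; norm_num
  have h3 : ∀ s, ∃ r, a r = (j s : ℤ) := by
    intro s
    by_contra hc
    push Not at hc
    apply h2
    apply Matrix.det_eq_zero_of_column_eq_zero s
    intro r
    simp only [Matrix.of_apply, v]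
    split_ifs with h0
    · rw [Finsupp.single_apply, if_neg]
      intro h4
      exact hc r (by omega)
    · simp
  choose τ hτ using h3
  have hτi : Function.Injective τ := by
    intro x y hxy
    apply hj
    have := hτ x
    rw [hxy, hτ y] at this
    exact_mod_cast this.symm
  let e : Equiv.Perm (Fin n) := Equiv.ofBijective τ (Finite.injective_iff_bijective.mp hτi)
  refine ⟨e.symm, fun r => ?_⟩
  have := hτ (e.symm r)
  rw [← this]
  congr 1
  exact (e.apply_symm_apply r).symm

lemma natAbs_le_Lnorm {n : ℕ} (l : Fin n → ℤ) (a : Fin n) : (l a).natAbs ≤ Lnorm l :=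
  Finset.single_le_sum (f := fun a => (l a).natAbs) (fun _ _ => Nat.zero_le _) (Finset.mem_univ a)

lemma Rcal_ncard {n : ℕ} (l : Fin n → ℤ) (d : ℕ) (j : Fin n → ℕ)
    (hgap : ∀ a b, a < b → j a + 4 * Lnorm l < j b) (hlow : ∀ r, d + Lnorm l ≤ j r) :
    Set.ncard (Rcal l d j) = Mcount l := by
  classical
  have hinj : Function.Injective j := by
    have : StrictMono j := fun a b hab => by have := hgap a b hab; omega
    exact this.injective
  have hL := natAbs_le_Lnorm l
  have key : Rcal l d j = (fun (v : Fin n → ℤ) (r : Fin n) => ((j r : ℤ) - v r).toNat) ''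
      ((Finset.univ.image fun π : Equiv.Perm (Fin n) => l ∘ π : Finset (Fin n → ℤ)) :
        Set (Fin n → ℤ)) := by
    ext i
    constructor
    · rintro ⟨⟨hd, hm⟩, π, hw⟩
      obtain ⟨σ, hσ⟩ := wedge_eq_perm _ j hinj hw
      have hmono : StrictMono σ := by
        intro a b hab
        by_contra hc
        have hne : σ b ≠ σ a := fun h => hab.ne' (σ.injective h)
        have hlt : σ b < σ a := lt_of_le_of_ne (not_lt.mp hc) hne
        have h1 := hgap _ _ hlt
        have h2 := hσ a
        have h3 := hσ b
        have h4 := hL (π a)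
        have h5 := hL (π b)
        have h6 := hm hab
        omega
      have hid : ∀ r, σ r = r := by
        let e : Fin n ≃o Fin n := hmono.orderIsoOfSurjective σ σ.surjective
        have he : e = OrderIso.refl _ := Subsingleton.elim _ _
        intro r
        have h9 : e r = r := by rw [he]; rfl
        exact h9
      refine ⟨l ∘ π, by simp, ?_⟩
      funext r
      have := hσ r
      rw [hid] at this
      simp only [Function.comp] at *
      omega
    · rintro ⟨v, hv, rfl⟩
      simp only [Finset.coe_image, Finset.coe_univ, Set.image_univ, Set.mem_range] at hv
      obtain ⟨π, rfl⟩ := hv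
      refine ⟨⟨fun r => ?_, fun a b hab => ?_⟩, π, ?_⟩
      · have := hL (π r); have := hlow r; simp only [Function.comp]; omega
      · have := hL (π a); have := hL (π b); have := hlow a; have := hlow b
        have := hgap a b hab
        simp only [Function.comp]; omega
      · congr 1
        funext r
        have := hL (π r); have := hlow r; simp only [Function.comp]; omega
  rw [key, Set.InjOn.ncard_image, Set.ncard_coe_finset]
  · unfold Mcount; congr!
  · intro v hv w hw hvw
    simp only [Finset.coe_image, Finset.coe_univ, Set.image_univ, Set.mem_range] at hv hw
    obtain ⟨π, rfl⟩ := hv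
    obtain ⟨ρ, rfl⟩ := hw
    funext r
    have := congrFun hvw r
    have := hL (π r); have := hL (ρ r); have := hlow r
    simp only [Function.comp] at *
    omega

lemma Gamma_gt (α : ℕ → ℂ) (ε : ℝ) (hε0 : 0 < ε) (N L i : ℕ) (t : ℤ)
    (hN : ∀ m, N ≤ m → 1 - ε < ‖α m‖) (ht : t.natAbs ≤ L) (hi : N + L ≤ i) :
    1 - ε < Gamma α i t := by
  unfold Gamma
  by_cases h0 : t = 0
  · rw [if_pos h0]; linarith
  · rw [if_neg h0]
    have hne : {x : ℝ | ∃ s : ℕ, s < t.natAbs ∧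
        x = ‖alphaE α (if 0 < t then (i : ℤ) + s else (i : ℤ) - 1 - s)‖}.Nonempty :=
      ⟨_, 0, by omega, rfl⟩
    have hfin : {x : ℝ | ∃ s : ℕ, s < t.natAbs ∧
        x = ‖alphaE α (if 0 < t then (i : ℤ) + s else (i : ℤ) - 1 - s)‖}.Finite := by
      refine ((Set.finite_lt_nat t.natAbs).image
        (fun s : ℕ => ‖alphaE α (if 0 < t then (i : ℤ) + s else (i : ℤ) - 1 - s)‖)).subset ?_
      rintro x ⟨s, hs, rfl⟩
      exact ⟨s, hs, rfl⟩
    obtain ⟨s, hs, hx⟩ := hne.csInf_mem hfin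
    rw [hx]
    unfold alphaE
    split_ifs with h1 h2 h2
    · apply hN; omega
    · omega
    · apply hN; omega
    · omega

/-- the slice of W -/
def Wk (n d k : ℕ) : Set (Fin n → ℕ) := {i | i ∈ Wset n d ∧ (∑ a, i a) = k}

lemma Wk_finite (n d k : ℕ) : (Wk n d k).Finite := by
  refine (Set.finite_Iic (fun _ : Fin n => k)).subset ?_
  rintro i ⟨-, hi⟩ r
  rw [← hi]
  exact Finset.single_le_sum (fun _ _ => Nat.zero_le _) (Finset.mem_univ r)

/-- slice with last gap one -/
def Uk (n d k : ℕ) : Set (Fin n → ℕ) :=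
  {i | i ∈ Wk n d k ∧ ∀ a b : Fin n, (a : ℕ) + 2 = n → (b : ℕ) + 1 = n → i b = i a + 1}

/-- part of `Uk` with a big gap at `r` -/
def Ur (n d k M : ℕ) (r : Fin n) : Set (Fin n → ℕ) :=
  {i | i ∈ Uk n d k ∧ (r : ℕ) + 1 < n ∧ d + M ≤ i r ∧ ∀ a < r, i a + M + 1 ≤ i r}

lemma Wk_mono (n d k : ℕ) (hn : 2 ≤ n) : (Wk n d k).ncard ≤ (Wk n d (k+1)).ncard := by
  let z : Fin n := ⟨n-1, by omega⟩
  refine Set.ncard_le_ncard_of_injOn (fun i => Function.update i z (i z + 1)) ?_ ?_ (Wk_finite _ _ _)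
  · rintro i ⟨⟨hd, hm⟩, hs⟩
    refine ⟨⟨fun r => ?_, fun a b hab => ?_⟩, ?_⟩
    · by_cases h : r = z
      · subst h; simp; have := hd z; omega
      · simp [h, hd]
    · have h1 : a ≠ z := by
        intro h; subst h; have := b.2; simp [z, Fin.lt_def] at hab; omega
      have h2 := hm hab
      by_cases h : b = z
      · subst h; simp [h1]; omega
      · simp [h, h1, h2]
    · rw [Finset.sum_update_of_mem (Finset.mem_univ z)]
      rw [← Finset.add_sum_erase _ _ (Finset.mem_univ z)] at hs
      rw [Finset.sdiff_singleton_eq_erase]; omega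
  · intro i _ i' _ h
    funext r
    have := congrFun h r
    by_cases hr : r = z
    · subst hr; simpa using this
    · simpa [hr] using this

lemma Wk_le (n d k : ℕ) (hn : 2 ≤ n) :
    (Wk n d (k+1)).ncard ≤ (Wk n d k).ncard + (Uk n d (k+1)).ncard := by
  let z : Fin n := ⟨n-1, by omega⟩
  have hU : Uk n d (k+1) ⊆ Wk n d (k+1) := fun i hi => hi.1
  rw [← Set.ncard_sdiff_add_ncard_of_subset hU (Wk_finite _ _ _)]
  refine Nat.add_le_add_right ?_ _
  refine Set.ncard_le_ncard_of_injOn (fun i => Function.update i z (i z - 1)) ?_ ?_ (Wk_finite n d k)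
  · rintro i ⟨hW, hnU⟩
    have hnU' : ∃ a : Fin n, (a : ℕ) + 2 = n ∧ i z ≠ i a + 1 := by
      by_contra hc
      push Not at hc
      refine hnU ⟨hW, fun a b ha hb => ?_⟩
      have : b = z := by ext; simp [z]; omega
      rw [this]; exact hc a ha
    obtain ⟨⟨hd, hm⟩, hs⟩ := hW
    obtain ⟨p, hp, hpz⟩ := hnU'
    have hpz' : i p < i z := hm (by simp [z, Fin.lt_def]; omega)
    refine ⟨⟨fun r => ?_, fun a b hab => ?_⟩, ?_⟩
    · by_cases h : r = z
      · subst h; simp; have := hd p; omega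
      · simp [h, hd]
    · have h1 : a ≠ z := by
        intro h; subst h; have := b.2; simp [z, Fin.lt_def] at hab; omega
      have h2 := hm hab
      by_cases h : b = z
      · have h9 : (a:ℕ) < n - 1 := by rw [h] at hab; exact hab
        have h10 : a ≤ p := by rw [Fin.le_def]; omega
        have h11 : i a ≤ i p := hm.monotone h10
        subst h; simp [h1]
        omega
      · simp [h, h1, h2]
    · rw [Finset.sum_update_of_mem (Finset.mem_univ z)]
      rw [← Finset.add_sum_erase _ _ (Finset.mem_univ z)] at hs
      rw [Finset.sdiff_singleton_eq_erase]; omega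
  · rintro i ⟨hi, _⟩ i' ⟨hi', _⟩ h
    have hpos : ∀ i ∈ Wk n d (k+1), 0 < i z := by
      rintro i ⟨⟨_, hm⟩, _⟩
      have : i ⟨0, by omega⟩ < i z := hm (by simp [z, Fin.lt_def]; omega)
      omega
    have := hpos i hi
    have := hpos i' hi'
    funext r
    have := congrFun h r
    by_cases hr : r = z
    · subst hr; simp at this; omega
    · simpa [hr] using this

lemma Ur_card (n d k M : ℕ) (hn : 2 ≤ n) (r : Fin n) :
    (Ur n d k M r).ncard * (M + 1) ≤ (Wk n d k).ncard := by
  classical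
  let z : Fin n := ⟨n-1, by omega⟩
  let p : Fin n := ⟨n-2, by omega⟩
  have hc : (Ur n d k M r).ncard * (M + 1) =
      ((Ur n d k M r) ×ˢ (Set.Iio (M+1))).ncard := by
    rw [Set.ncard_prod]
    congr 1
    rw [← Finset.coe_Iio, Set.ncard_coe_finset]; simp
  rw [hc]
  refine Set.ncard_le_ncard_of_injOn
    (fun q a => if a = z then q.1 a + (n - 1 - r) * q.2 else if r ≤ a then q.1 a - q.2 else q.1 a)
    ?_ ?_ (Wk_finite _ _ _)
  · rintro ⟨i, s⟩ ⟨⟨⟨⟨⟨hd, hm⟩, hs⟩, hu⟩, hr, hrd, hrg⟩, hsM⟩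
    simp only [Set.mem_Iio] at hsM hrd hrg hd hm hs
    refine ⟨⟨fun a => ?_, fun a b hab => ?_⟩, ?_⟩
    · have := hd a
      simp only
      split_ifs with h1 h2
      · nlinarith
      · have := hm.monotone h2; omega
      · exact this
    · have h1 : a ≠ z := by
        intro h; subst h; have := b.2; simp [z, Fin.lt_def] at hab; omega
      have h2 := hm hab
      simp only [h1, if_false]
      have hle : ∀ c, r ≤ c → s ≤ i c := fun c hc => by have := hm.monotone hc; omega
      have h7 : (if r ≤ a then i a - s else i a) ≤ i a := by split_ifs <;> omega
      by_cases h3 : b = z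
      · simp only [h3, if_true]
        rw [h3] at h2
        exact lt_of_le_of_lt h7 (lt_of_lt_of_le h2 (Nat.le_add_right _ _))
      · simp only [h3, if_false]
        by_cases h4 : r ≤ a
        · have h5 : r ≤ b := h4.trans hab.le
          have := hle a h4
          simp only [h4, h5, if_true]; omega
        · by_cases h5 : r ≤ b
          · simp only [h4, h5, if_true, if_false]
            have := hrg a (not_le.mp h4)
            have := hm.monotone h5
            omega
          · simp only [h4, h5, if_false]; exact h2
    · have hle : ∀ c, r ≤ c → s ≤ i c := fun c hc => by have := hm.monotone hc; omega
      have hpt : ∀ a : Fin n, ((if a = z then i a + (n - 1 - r) * s else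
          if r ≤ a then i a - s else i a : ℕ) : ℤ) =
          (i a : ℤ) + (if a = z then (((n - 1 - r) * s : ℕ) : ℤ) else 0)
            - (if a ∈ Finset.Ico r z then (s : ℤ) else 0) := by
        intro a
        have haz : a < z ↔ a ≠ z := by
          constructor
          · exact fun h => h.ne
          · intro h
            refine lt_of_le_of_ne ?_ h
            have := a.2
            simp [z, Fin.le_def]; omega
        simp only [Finset.mem_Ico, haz]
        by_cases h1 : a = z
        · simp [h1]
        · by_cases h2 : r ≤ a
          · have := hle a h2
            simp [h1, h2]; omega
          · simp [h1, h2]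
      apply Nat.cast_injective (R := ℤ)
      rw [Nat.cast_sum]
      refine (Finset.sum_congr rfl (fun a _ => hpt a)).trans ?_
      rw [Finset.sum_sub_distrib, Finset.sum_add_distrib]
      rw [Finset.sum_ite_eq' Finset.univ z, Finset.sum_ite_mem]
      simp only [Finset.mem_univ, if_true, Finset.univ_inter, Finset.sum_const, Fin.card_Ico]
      rw [← hs]
      simp [z]
  · rintro ⟨i, s⟩ ⟨⟨⟨⟨⟨hd, hm⟩, hs⟩, hu⟩, hr, hrd, hrg⟩, hsM⟩ ⟨i', s'⟩ ⟨⟨⟨⟨⟨hd', hm'⟩, hs'⟩, hu'⟩, hr', hrd', hrg'⟩, hsM'⟩ h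
    simp only [Set.mem_Iio] at hsM hrd hrg hd hm hs hsM' hrd' hrg' hd' hm' hs' h
    simp only at hu hu'
    have hz := congrFun h z
    have hp := congrFun h p
    have hpz : p ≠ z := by simp [p, z]; omega
    have hrp : r ≤ p := by simp [p, Fin.le_def]; omega
    simp only [if_true, hpz, hrp, if_false] at hz hp
    have e1 := hu p z (by simp [p]; omega) (by simp [z]; omega)
    have e2 := hu' p z (by simp [p]; omega) (by simp [z]; omega)
    have f1 := hm.monotone hrp
    have f2 := hm'.monotone hrp
    have hss : s = s' := by
      rcases lt_trichotomy s s' with hlt | heq | hlt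
      · have := Nat.mul_le_mul_left (n - 1 - (r:ℕ)) hlt.le
        omega
      · exact heq
      · have := Nat.mul_le_mul_left (n - 1 - (r:ℕ)) hlt.le
        omega
    subst hss
    ext a
    · have ha := congrFun h a
      show i a = i' a
      split_ifs at ha with h1 h2
      · omega
      · have := hm.monotone h2; have := hm'.monotone h2; omega
      · exact ha
    · rfl

lemma Uk_cover (n d k M : ℕ) (hn : 2 ≤ n) (hk : n * (d + n * (M+1) + 1) < k) :
    Uk n d k ⊆ ⋃ r, Ur n d k M r := by
  intro i hi
  by_contra hc
  simp only [Set.mem_iUnion, not_exists] at hc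
  have hU := hi
  obtain ⟨⟨⟨hd, hm⟩, hs⟩, hu⟩ := hi
  have key : ∀ m : ℕ, ∀ r : Fin n, (r : ℕ) = m → m + 1 < n → i r ≤ d + (m+1) * (M+1) := by
    intro m
    induction m using Nat.strong_induction_on with
    | _ m ih =>
      intro r hrm hmn
      by_contra hbig
      push Not at hbig
      refine hc r ⟨hU, by omega, by nlinarith, fun a ha => ?_⟩
      have h1 := ih a (by rw [← hrm]; exact ha) a rfl (by have : (a:ℕ) < r := ha; omega)
      have h2 : ((a:ℕ)+1) ≤ m := by rw [← hrm]; exact ha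
      have h3 := Nat.mul_le_mul_right (M+1) h2
      nlinarith
  have hall : ∀ a, i a ≤ d + n * (M+1) + 1 := by
    intro a
    by_cases ha : (a:ℕ) + 1 < n
    · have h1 := key a a rfl ha
      have h3 := Nat.mul_le_mul_right (M+1) ha.le
      omega
    · have h1 := key (n-2) ⟨n-2, by omega⟩ rfl (by omega)
      have h2 := hu ⟨n-2, by omega⟩ a (by simp; omega) (by omega)
      have h3 := Nat.mul_le_mul_right (M+1) (show n - 2 + 1 ≤ n by omega)
      omega
  have := Finset.sum_le_card_nsmul Finset.univ i _ (fun a _ => hall a)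
  simp only [Finset.card_univ, Fintype.card_fin, smul_eq_mul] at this
  rw [hs] at this
  omega

lemma Uk_card (n d k M : ℕ) (hn : 2 ≤ n) (hk : n * (d + n * (M+1) + 1) < k) :
    (Uk n d k).ncard * (M + 1) ≤ n * (Wk n d k).ncard := by
  have h1 : (Uk n d k).ncard ≤ ∑ r : Fin n, (Ur n d k M r).ncard := by
    refine (Set.ncard_le_ncard (Uk_cover n d k M hn hk) ?_).trans ?_
    · exact Set.finite_iUnion fun r => (Wk_finite n d k).subset fun i hi => hi.1.1
    · exact Set.ncard_iUnion_le_of_fintype _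
  calc _ ≤ (∑ r : Fin n, (Ur n d k M r).ncard) * (M+1) := Nat.mul_le_mul_right _ h1
    _ = ∑ r : Fin n, (Ur n d k M r).ncard * (M+1) := Finset.sum_mul _ _ _
    _ ≤ ∑ r : Fin n, (Wk n d k).ncard := Finset.sum_le_sum fun r _ => Ur_card n d k M hn r
    _ = _ := by simp

lemma Wk_mono_le (n d : ℕ) (hn : 2 ≤ n) : Monotone fun k => (Wk n d k).ncard :=
  monotone_nat_of_le_succ fun k => Wk_mono n d k hn

lemma Wk_pos (n d : ℕ) (hn : 2 ≤ n) : ∃ k0, ∀ k, k0 ≤ k → 0 < (Wk n d k).ncard := by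
  refine ⟨∑ a : Fin n, (d + a), fun k hk => lt_of_lt_of_le ?_ (Wk_mono_le n d hn hk)⟩
  rw [Set.ncard_pos (Wk_finite _ _ _)]
  exact ⟨fun a => d + a, ⟨fun r => Nat.le_add_right _ _, fun a b hab => by
    have : (a:ℕ) < b := hab
    simp only; omega⟩, rfl⟩

lemma ratio_one (n d : ℕ) (hn : 2 ≤ n) :
    Filter.Tendsto (fun k => ((Wk n d k).ncard : ℝ) / ((Wk n d (k+1)).ncard : ℝ))
      Filter.atTop (nhds 1) := by
  rw [Metric.tendsto_atTop]
  intro δ hδ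
  obtain ⟨k0, hk0⟩ := Wk_pos n d hn
  obtain ⟨M, hM⟩ := exists_nat_gt ((n : ℝ) / δ)
  refine ⟨k0 + n * (d + n * (M+1) + 1), fun k hk => ?_⟩
  have h1 : (0:ℝ) < ((Wk n d (k+1)).ncard : ℝ) := by exact_mod_cast hk0 (k+1) (by omega)
  have h2 : ((Wk n d k).ncard : ℝ) ≤ (Wk n d (k+1)).ncard := by exact_mod_cast Wk_mono n d k hn
  have h3 : ((Wk n d (k+1)).ncard : ℝ) ≤ (Wk n d k).ncard + (Uk n d (k+1)).ncard := by
    exact_mod_cast Wk_le n d k hn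
  have h4 : ((Uk n d (k+1)).ncard : ℝ) * (M + 1) ≤ n * (Wk n d (k+1)).ncard := by
    exact_mod_cast Uk_card n d (k+1) M hn (by omega)
  rw [Real.dist_eq, abs_sub_comm, abs_of_nonneg (by
    rw [sub_nonneg, div_le_one h1]; exact h2)]
  rw [div_lt_iff₀ hδ] at hM
  have hM1 : (0:ℝ) < M + 1 := by positivity
  have h5 : ((Uk n d (k+1)).ncard : ℝ) < δ * (Wk n d (k+1)).ncard := by
    by_contra hc
    push Not at hc
    have := mul_le_mul_of_nonneg_right hc hM1.le
    nlinarith [mul_pos h1 hδ, mul_lt_mul_of_pos_right hM h1]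
  rw [sub_lt_comm, lt_div_iff₀ h1]
  linarith

lemma ratio_shift (n d : ℕ) (hn : 2 ≤ n) (Q : ℕ) :
    Filter.Tendsto (fun k => ((Wk n d k).ncard : ℝ) / ((Wk n d (k+Q)).ncard : ℝ))
      Filter.atTop (nhds 1) := by
  obtain ⟨k0, hk0⟩ := Wk_pos n d hn
  induction Q with
  | zero =>
    refine tendsto_const_nhds.congr' ?_
    filter_upwards [Filter.eventually_ge_atTop k0] with k hk
    have : ((Wk n d k).ncard : ℝ) ≠ 0 := by exact_mod_cast (hk0 k hk).ne'
    simp [this]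
  | succ Q ih =>
    have h := ih.mul ((Filter.tendsto_add_atTop_iff_nat Q).mpr (ratio_one n d hn))
    rw [one_mul] at h
    refine h.congr' ?_
    filter_upwards [Filter.eventually_ge_atTop k0] with k hk
    have : ((Wk n d (k+Q)).ncard : ℝ) ≠ 0 := by exact_mod_cast (hk0 (k+Q) (by omega)).ne'
    rw [← add_assoc]
    field_simp

lemma A_upper {n : ℕ} (l : Fin n → ℤ) (d k q : ℕ) (α : ℕ → ℂ) (ε : ℝ)
    (hq : (q : ℤ) = k + ∑ a, l a) :
    Set.ncard (AtildeCal l d α ε (k : ℤ) ∩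
            EcalP l d ((k : ℤ) + ∑ a, l a) (Mcount l)) ≤ (Wk n d q).ncard := by
  refine Set.ncard_le_ncard ?_ (Wk_finite _ _ _)
  rintro j ⟨-, ⟨hW, -⟩, hs, -⟩
  refine ⟨hW, ?_⟩
  rw [← hq] at hs
  exact_mod_cast hs

lemma A_lower {n : ℕ} (l : Fin n → ℤ) (d k q N : ℕ) (α : ℕ → ℂ) (ε : ℝ) (hε0 : 0 < ε)
    (hN : ∀ m, N ≤ m → 1 - ε < ‖α m‖)
    (hq : (q : ℤ) + (∑ a : Fin n, (N + Lnorm l + 4 * Lnorm l * a) : ℕ) = k + ∑ a, l a) :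
    (Wk n d q).ncard ≤ Set.ncard (AtildeCal l d α ε (k : ℤ) ∩
            EcalP l d ((k : ℤ) + ∑ a, l a) (Mcount l)) := by
  have hfin : (AtildeCal l d α ε (k : ℤ) ∩
            EcalP l d ((k : ℤ) + ∑ a, l a) (Mcount l)).Finite := by
    refine (Wk_finite n d ((k : ℤ) + ∑ a, l a).toNat).subset ?_
    rintro j ⟨-, ⟨hW, -⟩, hs, -⟩
    refine ⟨hW, ?_⟩
    rw [← hs, ← Nat.cast_sum, Int.toNat_natCast]
  refine Set.ncard_le_ncard_of_injOn
    (fun i a => i a + (N + Lnorm l + 4 * Lnorm l * a)) ?_ ?_ hfin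
  · rintro i ⟨⟨hd, hm⟩, hs⟩
    set j : Fin n → ℕ := fun a => i a + (N + Lnorm l + 4 * Lnorm l * a) with hj
    have hgap : ∀ a b, a < b → j a + 4 * Lnorm l < j b := by
      intro a b hab
      have h1 := hm hab
      have h2 : (a : ℕ) + 1 ≤ b := hab
      have h3 := Nat.mul_le_mul_left (4 * Lnorm l) h2
      rw [mul_add] at h3
      simp only [hj]
      omega
    have hlow : ∀ r, d + (N + Lnorm l) ≤ j r := by
      intro r
      have := hd r
      simp only [hj]; omega
    have hW : j ∈ Wset n d :=
      ⟨fun r => by have := hlow r; omega, fun a b hab => by have := hgap a b hab; omega⟩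
    have hR := Rcal_ncard l d j hgap (fun r => by have := hlow r; omega)
    have hsum : (∑ a, (j a : ℤ)) = (k : ℤ) + ∑ a, l a := by
      rw [← hq, ← hs, ← Nat.cast_add, ← Finset.sum_add_distrib, Nat.cast_sum]
    refine ⟨⟨⟨⟨j, hW, fun _ => 0, by simp, by simp, ?_⟩, hsum, hR⟩, ?_⟩,
      ⟨hW, fun a b hab => hgap a b (by rw [Fin.lt_def]; omega)⟩, hsum, hR⟩
    · intro a b hab
      simp only [add_zero, Nat.cast_inj] at hab
      exact hW.2.injective hab
    · intro m π
      refine Gamma_gt α ε hε0 N (Lnorm l) _ _ hN ?_ ?_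
      · rw [Int.natAbs_neg]; exact natAbs_le_Lnorm l _
      · have := hlow m; omega
  · intro i _ i' _ h
    funext a
    have := congrFun h a
    simp only at this
    omega

/-- If the weight `α` is regular with limit `1`, `l₁,…,lₙ` are not all equal, and
`0 < ε < 1`, then `lim_{k→∞} (#𝒜̃′_{k+S_𝔩,𝓜,ε}) / W_{(k,n)} = 1`, where
`𝒜̃′_{k+S_𝔩,𝓜,ε} = 𝒜̃_{k+S_𝔩,𝓜,ε} ∩ 𝓔′_{k+S_𝔩,𝓜}` and `W_{(k,n)} = #{i ∈ W : |i| = k}`. -/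
theorem statement17 {n : ℕ} (hn : 2 ≤ n) (l : Fin n → ℤ)
    (hl : ¬ ∀ a b : Fin n, l a = l b) (d : ℕ) (hd : 1 ≤ d)
    (α : ℕ → ℂ)
    (hlim : Filter.Tendsto (fun i => ‖α i‖) Filter.atTop (nhds 1))
    (hbd : ∀ m : ℕ, ‖α m‖ ≤ 1)
    (ε : ℝ) (hε0 : 0 < ε) (hε1 : ε < 1) :
    Filter.Tendsto
      (fun k : ℕ =>
        (Set.ncard (AtildeCal l d α ε (k : ℤ) ∩
            EcalP l d ((k : ℤ) + ∑ a, l a) (Mcount l)) : ℝ) /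
          (Set.ncard {i : Fin n → ℕ | i ∈ Wset n d ∧ (∑ a, i a) = k} : ℝ))
      Filter.atTop (nhds 1) := by
  obtain ⟨N, hN⟩ : ∃ N, ∀ m, N ≤ m → 1 - ε < ‖α m‖ := by
    have := hlim.eventually (lt_mem_nhds (show 1 - ε < 1 by linarith))
    exact Filter.eventually_atTop.mp this
  let C : ℕ := ∑ a : Fin n, (N + Lnorm l + 4 * Lnorm l * a)
  let Q : ℕ := (∑ a, l a).natAbs + C
  have hmono := Wk_mono_le n d hn
  obtain ⟨k0, hk0⟩ := Wk_pos n d hn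
  have hlo : Filter.Tendsto (fun k => ((Wk n d (k - Q)).ncard : ℝ) / ((Wk n d k).ncard : ℝ))
      Filter.atTop (nhds 1) := by
    rw [← Filter.tendsto_add_atTop_iff_nat Q]
    simpa using ratio_shift n d hn Q
  have hhi : Filter.Tendsto (fun k => ((Wk n d (k + Q)).ncard : ℝ) / ((Wk n d k).ncard : ℝ))
      Filter.atTop (nhds 1) := by
    simpa using (ratio_shift n d hn Q).inv₀ one_ne_zero
  refine tendsto_of_tendsto_of_tendsto_of_le_of_le' hlo hhi ?_ ?_
  · filter_upwards [Filter.eventually_ge_atTop Q] with k hk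
    change _ ≤ _ / ((Wk n d k).ncard : ℝ)
    refine div_le_div_of_nonneg_right (Nat.cast_le.mpr ?_) (Nat.cast_nonneg _)
    obtain ⟨q, hq⟩ : ∃ q : ℕ, (q : ℤ) = k + ∑ a, l a - C :=
      ⟨(k + ∑ a, l a - C : ℤ).toNat, by omega⟩
    refine (hmono (show k - Q ≤ q by omega)).trans ?_
    exact A_lower l d k q N α ε hε0 hN (by change (q : ℤ) + (C : ℤ) = _; omega)
  · filter_upwards [Filter.eventually_ge_atTop Q] with k hk
    change _ / ((Wk n d k).ncard : ℝ) ≤ _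
    refine div_le_div_of_nonneg_right (Nat.cast_le.mpr ?_) (Nat.cast_nonneg _)
    obtain ⟨q, hq⟩ : ∃ q : ℕ, (q : ℤ) = k + ∑ a, l a :=
      ⟨(k + ∑ a, l a : ℤ).toNat, by omega⟩
    exact (A_upper l d k q α ε hq).trans (hmono (show q ≤ k + Q by omega))
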